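/- With the notation of the previous statement, let b(g) = 𝟙_{g·x₀} − 𝟙_{x₀} be the Haagerup cocycle, v_n = −Σ_{k=0}^{n} (1 − k/n)·𝟚_{x_k, x_{k+1}}, and b_n(g) = g·v_n − v_n. Then for every integer N with 0 ≤ N ≤ M and every n > M: ‖b(a^N) − b_n(a^N)‖² ≤ 6 ℓ(a) M² / n. In particular, b(a^N) is approximated by coboundaries as n → ∞, uniformly for 0 ≤ N ≤ M. -/

import Mathlib

open SimpleGraph

open Classical in
/-- Characteristic function of the oriented edges (adjacent ordered pairs) pointing towards `x`. -/
noncomputable def towardInd {V : Type*} (T : SimpleGraph V) (x : V) : V × V → ℝ :=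
  fun p => if T.Adj p.1 p.2 ∧ T.dist p.2 x < T.dist p.1 x then 1 else 0

open Classical in
/-- Characteristic function of the oriented edges lying on the geodesic `[x,y]`, oriented
from `x` towards `y`. -/
noncomputable def segInd {V : Type*} (T : SimpleGraph V) (x y : V) : V × V → ℝ :=
  fun p => if T.Adj p.1 p.2 ∧ T.dist x p.1 + 1 + T.dist p.2 y = T.dist x y then 1 else 0

/-- `𝟚_{x,y} = 𝟙_{[x,y]} − 𝟙_{[y,x]}`. -/
noncomputable def twoFun {V : Type*} (T : SimpleGraph V) (x y : V) : V × V → ℝ :=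
  fun p => segInd T x y p - segInd T y x p

section TreeDistance

variable {V : Type*} {T : SimpleGraph V}

/-- In a tree, an edge `uv` with `x` on the side of `u` and `y` on the side of `v` lies on the
geodesic from `x` to `y`. -/
theorem dist_eq_of_edge_separates (hT : T.IsTree) {u v x y : V} (huv : T.Adj u v)
    (hx : T.dist u x < T.dist v x) (hy : T.dist v y < T.dist u y) :
    T.dist x u + 1 + T.dist v y = T.dist x y := by
  have htri : ∀ a b c, T.dist a c ≤ T.dist a b + T.dist b c := fun a b c =>
    hT.connected.dist_triangle
  have hcomm : ∀ a b, T.dist a b = T.dist b a := fun _ _ => dist_comm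
  obtain ⟨P, hP, hPl⟩ := hT.connected.exists_path_of_dist x u
  obtain ⟨Q, hQ, hQl⟩ := hT.connected.exists_path_of_dist v y
  obtain ⟨R, hR, hRl⟩ := hT.connected.exists_path_of_dist x y
  have hpath : (P.append (Walk.cons huv Q)).IsPath := by
    rw [Walk.isPath_def, Walk.support_append, Walk.support_cons, List.tail_cons]
    refine List.nodup_append'.2 ⟨hP.support_nodup, hQ.support_nodup, fun z hzP hzQ => ?_⟩
    obtain ⟨P₁, P₂, rfl⟩ := Walk.mem_support_iff_exists_append.1 hzP
    obtain ⟨Q₁, Q₂, rfl⟩ := Walk.mem_support_iff_exists_append.1 hzQ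
    rw [Walk.length_append] at hPl hQl
    have := dist_le P₁
    have := dist_le P₂
    have := dist_le Q₁
    have := dist_le Q₂
    have := htri v z x
    have := htri u z y
    have := hcomm u x
    have := hcomm z x
    have := hcomm u z
    lia
  have hEq := (hT.existsUnique_path x y).unique hR hpath
  rw [← hRl, hEq, Walk.length_append, Walk.length_cons, hPl, hQl]
  ring

theorem dist_add_one_add_dist_eq_iff (hT : T.IsTree) {u v : V} (huv : T.Adj u v) (x y : V) :
    T.dist x u + 1 + T.dist v y = T.dist x y ↔
      T.dist u x < T.dist v x ∧ T.dist v y < T.dist u y := by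
  refine ⟨fun h => ?_, fun h => dist_eq_of_edge_separates hT huv h.1 h.2⟩
  have h₁ : T.dist x y ≤ T.dist x u + T.dist u y := hT.connected.dist_triangle
  have h₂ : T.dist x y ≤ T.dist x v + T.dist v y := hT.connected.dist_triangle
  rw [T.dist_comm (u := u) (v := x), T.dist_comm (u := v) (v := x)]
  lia

theorem twoFun_eq_sub_towardInd (hT : T.IsTree) (x y : V) (p : V × V) :
    twoFun T x y p = towardInd T y p - towardInd T x p := by
  obtain ⟨u, v⟩ := p
  unfold twoFun segInd towardInd
  by_cases huv : T.Adj u v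
  · have hx := hT.dist_ne_of_adj x huv
    have hy := hT.dist_ne_of_adj y huv
    rw [T.dist_comm (u := x) (v := u), T.dist_comm (u := x) (v := v)] at hx
    rw [T.dist_comm (u := y) (v := u), T.dist_comm (u := y) (v := v)] at hy
    simp only [huv, true_and, dist_add_one_add_dist_eq_iff hT huv]
    rcases hx.lt_or_gt with hx | hx <;> rcases hy.lt_or_gt with hy | hy <;>
      simp [hx, hy, hx.not_gt, hy.not_gt]
  · simp [huv]

theorem towardInd_eq_of_adj (hT : T.IsTree) {x y : V} {p : V × V}
    (h₁ : p ≠ (x, y)) (h₂ : p ≠ (y, x)) (hxy : T.Adj x y) :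
    towardInd T x p = towardInd T y p := by
  classical
  have seg : ∀ a b, T.Adj a b → p ≠ (a, b) → segInd T a b p = 0 := by
    intro a b hab hp
    refine if_neg fun h => hp ?_
    have hd := h.2
    rw [dist_eq_one_iff_adj.2 hab] at hd
    have ha : T.dist a p.1 = 0 := by lia
    have hb : T.dist p.2 b = 0 := by lia
    rw [hT.connected.dist_eq_zero_iff] at ha hb
    exact Prod.ext ha.symm hb
  have h := twoFun_eq_sub_towardInd hT x y p
  rw [twoFun, seg x y hxy h₁, seg y x hxy.symm h₂] at h
  linarith

theorem exists_finset_towardInd_eq (hT : T.IsTree) {x y : V} (w : T.Walk x y) :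
    ∃ S : Finset (V × V), S.card ≤ 2 * w.length ∧
      ∀ p ∉ S, towardInd T x p = towardInd T y p := by
  classical
  induction w with
  | nil => exact ⟨∅, by simp⟩
  | @cons a b c h w ih =>
    obtain ⟨S, hS, hSp⟩ := ih
    refine ⟨insert (a, b) (insert (b, a) S), ?_, fun p hp => ?_⟩
    · have := Finset.card_insert_le (a, b) (insert (b, a) S)
      have := Finset.card_insert_le (b, a) S
      rw [Walk.length_cons]
      lia
    · simp only [Finset.mem_insert, not_or] at hp
      rw [towardInd_eq_of_adj hT hp.1 hp.2.1 h, hSp p hp.2.2]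

theorem sq_towardInd_sub_le_one (x y : V) (p : V × V) :
    (towardInd T y p - towardInd T x p) ^ 2 ≤ 1 := by
  unfold towardInd
  split_ifs <;> norm_num

/-- The Haagerup cocycle satisfies `‖𝟙_y − 𝟙_x‖² ≤ 2 d(x, y)`. -/
theorem summable_and_tsum_sq_towardInd_sub_le (hT : T.IsTree) (x y : V) :
    Summable (fun p => (towardInd T y p - towardInd T x p) ^ 2) ∧
      ∑' p, (towardInd T y p - towardInd T x p) ^ 2 ≤ 2 * (T.dist x y : ℝ) := by
  obtain ⟨w, hw⟩ := hT.connected.exists_walk_length_eq_dist x y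
  obtain ⟨S, hS, hSp⟩ := exists_finset_towardInd_eq hT w
  have hzero : ∀ p ∉ S, (towardInd T y p - towardInd T x p) ^ 2 = 0 := fun p hp => by
    simp [hSp p hp]
  refine ⟨summable_of_ne_finset_zero hzero, ?_⟩
  rw [tsum_eq_sum hzero]
  calc ∑ p ∈ S, (towardInd T y p - towardInd T x p) ^ 2 ≤ ∑ _p ∈ S, (1 : ℝ) :=
        Finset.sum_le_sum fun p _ => sq_towardInd_sub_le_one x y p
    _ = S.card := by simp
    _ ≤ 2 * (T.dist x y : ℝ) := by rw [← hw]; exact_mod_cast hS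

/-- A sum of `m` differences `𝟙_{y_j} − 𝟙_{x_j}`, scaled by `c`, has squared norm at most
`2 c² m² D` when all distances `d(x_j, y_j)` are at most `D`. -/
theorem tsum_sq_sum_towardInd_sub_le (hT : T.IsTree) (x y : ℕ → V) (m D : ℕ) (c : ℝ)
    (hD : ∀ j, T.dist (x j) (y j) ≤ D) :
    ∑' p, (c * ∑ j ∈ Finset.range m, (towardInd T (y j) p - towardInd T (x j) p)) ^ 2 ≤
      2 * c ^ 2 * (m : ℝ) ^ 2 * D := by
  have hs : ∀ j, Summable (fun p => (towardInd T (y j) p - towardInd T (x j) p) ^ 2) :=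
    fun j => (summable_and_tsum_sq_towardInd_sub_le hT (x j) (y j)).1
  have hsum : Summable (fun p => c ^ 2 * m *
      ∑ j ∈ Finset.range m, (towardInd T (y j) p - towardInd T (x j) p) ^ 2) :=
    (summable_sum fun j _ => hs j).mul_left _
  have hle : ∀ p, (c * ∑ j ∈ Finset.range m, (towardInd T (y j) p - towardInd T (x j) p)) ^ 2 ≤
      c ^ 2 * m * ∑ j ∈ Finset.range m, (towardInd T (y j) p - towardInd T (x j) p) ^ 2 := by
    intro p
    rw [mul_pow, mul_assoc]
    gcongr
    simpa using sq_sum_le_card_mul_sum_sq (s := Finset.range m)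
      (f := fun j => towardInd T (y j) p - towardInd T (x j) p)
  calc _ ≤ ∑' p, c ^ 2 * m *
        ∑ j ∈ Finset.range m, (towardInd T (y j) p - towardInd T (x j) p) ^ 2 :=
        (hsum.of_nonneg_of_le (fun _ => sq_nonneg _) hle).tsum_le_tsum hle hsum
    _ = c ^ 2 * m * ∑ j ∈ Finset.range m,
        ∑' p, (towardInd T (y j) p - towardInd T (x j) p) ^ 2 := by
        rw [tsum_mul_left, Summable.tsum_finsetSum fun j _ => hs j]
    _ ≤ c ^ 2 * m * ∑ _j ∈ Finset.range m, 2 * (D : ℝ) := by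
        gcongr with j
        refine (summable_and_tsum_sq_towardInd_sub_le hT (x j) (y j)).2.trans ?_
        have : (T.dist (x j) (y j) : ℝ) ≤ D := by exact_mod_cast hD j
        linarith
    _ = _ := by simp; ring

end TreeDistance

section Action

variable {V : Type*} {T : SimpleGraph V} {G : Type*} [Group G] [MulAction G V]

theorem dist_smul_smul_le (hT : T.IsTree)
    (hact : ∀ (g : G) (a b : V), T.Adj a b ↔ T.Adj (g • a) (g • b)) (g : G) (u v : V) :
    T.dist (g • u) (g • v) ≤ T.dist u v := by
  obtain ⟨w, hw⟩ := hT.connected.exists_walk_length_eq_dist u v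
  let f : T →g T := ⟨fun x => g • x, fun h => (hact g _ _).1 h⟩
  rw [← hw, ← Walk.length_map f w]
  exact dist_le (w.map f)

theorem dist_smul_smul (hT : T.IsTree)
    (hact : ∀ (g : G) (a b : V), T.Adj a b ↔ T.Adj (g • a) (g • b)) (g : G) (u v : V) :
    T.dist (g • u) (g • v) = T.dist u v := by
  refine (dist_smul_smul_le hT hact g u v).antisymm ?_
  simpa using dist_smul_smul_le hT hact g⁻¹ (g • u) (g • v)

theorem towardInd_inv_smul (hT : T.IsTree)
    (hact : ∀ (g : G) (a b : V), T.Adj a b ↔ T.Adj (g • a) (g • b)) (g : G) (x : V)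
    (p : V × V) : towardInd T x (g⁻¹ • p) = towardInd T (g • x) p := by
  have hd : ∀ u, T.dist (g⁻¹ • u) x = T.dist u (g • x) := fun u => by
    simpa using (dist_smul_smul hT hact g (g⁻¹ • u) x).symm
  unfold towardInd
  classical
  refine if_congr (and_congr (hact g⁻¹ _ _).symm ?_) rfl rfl
  rw [Prod.smul_fst, Prod.smul_snd, hd, hd]

theorem dist_pow_smul_le (hT : T.IsTree)
    (hact : ∀ (g : G) (a b : V), T.Adj a b ↔ T.Adj (g • a) (g • b)) (a : G) (x : V) (n : ℕ) :
    T.dist x (a ^ n • x) ≤ n * T.dist x (a • x) := by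
  induction n with
  | zero => simp
  | succ n ih =>
    have h : T.dist x (a ^ (n + 1) • x) ≤
        T.dist x (a ^ n • x) + T.dist (a ^ n • x) (a ^ (n + 1) • x) :=
      hT.connected.dist_triangle
    rw [pow_succ, mul_smul, dist_smul_smul hT hact] at h
    rw [pow_succ, mul_smul]
    linarith

end Action

/-- Summation by parts with the weights `1 − k/n`, which vanish at `k = n`. -/
theorem sum_one_sub_div_mul_sub (t : ℕ → ℝ) {n : ℕ} (hn : 0 < n) :
    ∑ k ∈ Finset.range (n + 1), (1 - (k : ℝ) / n) * (t (k + 1) - t k) =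
      1 / n * ∑ k ∈ Finset.range n, t (k + 1) - t 0 := by
  have hn' : (n : ℝ) ≠ 0 := by positivity
  have key : ∀ m : ℕ, ∑ k ∈ Finset.range m, (1 - (k : ℝ) / n) * (t (k + 1) - t k) =
      1 / n * ∑ k ∈ Finset.range m, t (k + 1) - t 0 + (1 - (m : ℝ) / n) * t m := by
    intro m
    induction m with
    | zero => simp
    | succ m ih =>
      rw [Finset.sum_range_succ, ih, Finset.sum_range_succ]
      push_cast
      ring
  rw [Finset.sum_range_succ, key, div_self hn']
  ring

theorem sum_range_shift_sub_sum_range (t : ℕ → ℝ) (n N : ℕ) :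
    ∑ k ∈ Finset.range n, t (N + k) - ∑ k ∈ Finset.range n, t k =
      ∑ j ∈ Finset.range N, (t (n + j) - t j) := by
  have h₁ := Finset.sum_range_add t n N
  have h₂ := Finset.sum_range_add t N n
  rw [add_comm N n] at h₂
  rw [Finset.sum_sub_distrib]
  linarith

/-- With `a` a hyperbolic automorphism of a tree with translation length `ℓ`, base vertex `x₀`
on its axis, `x_k = aᵏ•x₀`, Haagerup cocycle `b(g) = 𝟙_{g•x₀} − 𝟙_{x₀}`,
`v_n = −Σ_{k=0}^{n} (1 − k/n)·𝟚_{x_k,x_{k+1}}`, and coboundary `b_n(g) = g·v_n − v_n`: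
for all `0 ≤ N ≤ M < n` one has `‖b(a^N) − b_n(a^N)‖² ≤ 6 ℓ M² / n`. -/
theorem stmt14 {V : Type*} (T : SimpleGraph V) (hT : T.IsTree) {G : Type*} [Group G]
    [MulAction G V] (hact : ∀ (g : G) (a b : V), T.Adj a b ↔ T.Adj (g • a) (g • b))
    (a : G) (ℓ : ℕ) (hl : 0 < ℓ)
    (hmin : ∀ v : V, ℓ ≤ T.dist v (a • v))
    (x₀ : V) (hx₀ : T.dist x₀ (a • x₀) = ℓ)
    (M N n : ℕ) (hNM : N ≤ M) (hMn : M < n) :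
    let xk : ℕ → V := fun k => a ^ k • x₀
    let vn : V × V → ℝ := fun p =>
      -(∑ k ∈ Finset.range (n + 1), (1 - (k : ℝ) / (n : ℝ)) * twoFun T (xk k) (xk (k + 1)) p)
    ∑' p : V × V,
        ((towardInd T (xk N) p - towardInd T x₀ p) - (vn ((a ^ N)⁻¹ • p) - vn p)) ^ 2
      ≤ 6 * (ℓ : ℝ) * (M : ℝ) ^ 2 / (n : ℝ) := by
  intro xk vn
  have hn : 0 < n := by lia
  have hvn : ∀ p, vn p = towardInd T (xk 0) p -
      1 / n * ∑ k ∈ Finset.range n, towardInd T (xk (k + 1)) p := by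
    intro p
    simp only [vn, twoFun_eq_sub_towardInd hT]
    rw [sum_one_sub_div_mul_sub (fun k => towardInd T (xk k) p) hn]
    ring
  have hshift : ∀ k p, towardInd T (xk k) ((a ^ N)⁻¹ • p) = towardInd T (xk (N + k)) p := by
    intro k p
    rw [towardInd_inv_smul hT hact, smul_smul, ← pow_add]
  have hx0 : xk 0 = x₀ := by simp [xk]
  have hterm : ∀ p, (towardInd T (xk N) p - towardInd T x₀ p) - (vn ((a ^ N)⁻¹ • p) - vn p) =
      1 / n * ∑ j ∈ Finset.range N,
        (towardInd T (xk (n + j + 1)) p - towardInd T (xk (j + 1)) p) := by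
    intro p
    rw [hvn, hvn, hshift 0, add_zero, hx0,
      ← sum_range_shift_sub_sum_range (fun k => towardInd T (xk (k + 1)) p)]
    simp only [hshift, add_assoc]
    ring
  have hdist : ∀ j, T.dist (xk (j + 1)) (xk (n + j + 1)) ≤ n * ℓ := by
    intro j
    have h := dist_pow_smul_le hT hact a x₀ n
    rw [hx₀, ← dist_smul_smul hT hact (a ^ (j + 1)), smul_smul, ← pow_add] at h
    rwa [show j + 1 + n = n + j + 1 by ring] at h
  simp only [hterm]
  refine (tsum_sq_sum_towardInd_sub_le hT (fun j => xk (j + 1)) (fun j => xk (n + j + 1)) N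
    (n * ℓ) (1 / n) hdist).trans ?_
  have hn' : (0 : ℝ) < n := by exact_mod_cast hn
  have hNM' : (N : ℝ) ≤ M := by exact_mod_cast hNM
  calc 2 * (1 / (n : ℝ)) ^ 2 * (N : ℝ) ^ 2 * ((n * ℓ : ℕ) : ℝ) = 2 * ℓ * (N : ℝ) ^ 2 / n := by
        push_cast
        field_simp
    _ ≤ 6 * ℓ * (M : ℝ) ^ 2 / n := by
        gcongr
        norm_num
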